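/- Let K be a field, m < n positive integers, and f = (∏_{k=0}^{m-2} det(X_{[1,k+1]}^{[m-k,m]}) · det(X_{[n-k,n]}^{[1,k+1]})) · ∏_{k=1}^{n-m+1} det(X_{[k,m+k-1]}) in S = K[x_{ij}]. Then for every t with 1 ≤ t ≤ m and all column indices 1 ≤ a < b ≤ n with b − a + 1 ≥ t, the ideal I_t(X_{[a,b]}) generated by the t×t minors of the submatrix of X on columns a,...,b belongs to C_f. -/

import Mathlib

/-- The ideal of `t × t` minors of the generic `m × n` matrix `X` (with entries
`X i j = MvPolynomial.X (i, j)`), using only rows with 1-based index in `[r1, r2]`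
and columns with 1-based index in `[c1, c2]`. -/
noncomputable def genMinors (K : Type*) [Field K] (m n : ℕ) (t : ℕ) (r1 r2 c1 c2 : ℕ) :
    Ideal (MvPolynomial (Fin m × Fin n) K) :=
  Ideal.span { p | ∃ (r : Fin t → Fin m) (c : Fin t → Fin n),
    StrictMono r ∧ StrictMono c ∧
    (∀ i, r1 ≤ (r i).val + 1 ∧ (r i).val + 1 ≤ r2) ∧
    (∀ j, c1 ≤ (c j).val + 1 ∧ (c j).val + 1 ≤ c2) ∧
    p = Matrix.det (Matrix.of fun i j => MvPolynomial.X (r i, c j)) }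

/-- The polynomial
`f = (∏_{k=0}^{m-2} det X_{[1,k+1]}^{[m-k,m]} ⬝ det X_{[n-k,n]}^{[1,k+1]}) ⬝ ∏_{k=1}^{n-m+1} det X_{[k,m+k-1]}`
(1-based intervals, subscripts = columns, superscripts = rows). -/
noncomputable def knutsonF (K : Type*) [Field K] (m n : ℕ) (hm : 0 < m) (hmn : m < n) :
    MvPolynomial (Fin m × Fin n) K :=
  (∏ k : Fin (m - 1),
      (Matrix.det (Matrix.of fun (i j : Fin (k.val + 1)) =>
        MvPolynomial.X ((⟨m - 1 - k.val + i.val, by omega⟩ : Fin m),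
                        (⟨j.val, by omega⟩ : Fin n)))
      * Matrix.det (Matrix.of fun (i j : Fin (k.val + 1)) =>
        MvPolynomial.X ((⟨i.val, by omega⟩ : Fin m),
                        (⟨n - 1 - k.val + j.val, by omega⟩ : Fin n)))))
  * ∏ k : Fin (n - m + 1),
      Matrix.det (Matrix.of fun (i j : Fin m) =>
        MvPolynomial.X ((⟨i.val, i.isLt⟩ : Fin m), (⟨k.val + j.val, by omega⟩ : Fin n)))

/-- The family of Knutson ideals `C_f`: the smallest set of ideals containing `(f)`,
closed under colon ideals by arbitrary ideals, and under sums and intersections. -/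
inductive IsKnutson {K : Type*} [Field K] {m n : ℕ}
    (f : MvPolynomial (Fin m × Fin n) K) : Ideal (MvPolynomial (Fin m × Fin n) K) → Prop
  | base : IsKnutson f (Ideal.span {f})
  | colon (I J : Ideal (MvPolynomial (Fin m × Fin n) K)) :
      IsKnutson f I → IsKnutson f (I.colon J)
  | add (I J : Ideal (MvPolynomial (Fin m × Fin n) K)) :
      IsKnutson f I → IsKnutson f J → IsKnutson f (I + J)
  | inf (I J : Ideal (MvPolynomial (Fin m × Fin n) K)) :
      IsKnutson f I → IsKnutson f J → IsKnutson f (I ⊓ J)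

set_option linter.all false
open MvPolynomial

open Finset in
/-- mass of `v` to the south-east of `(a,b)` -/
def seMass {m n : ℕ} (v : Fin m × Fin n → ℕ) (a b : ℕ) : ℕ :=
  ∑ e, if a ≤ e.1.val ∧ b ≤ e.2.val then v e else 0

open Finset in
lemma sum_seMass {m n : ℕ} (v : Fin m × Fin n → ℕ) :
    ∑ a ∈ range m, ∑ b ∈ range n, seMass v a b = ∑ e, v e * ((e.1.val + 1) * (e.2.val + 1)) := by
  unfold seMass
  have : ∀ a ∈ range m, ∑ b ∈ range n, ∑ e : Fin m × Fin n,
      (if a ≤ e.1.val ∧ b ≤ e.2.val then v e else 0) = ∑ e : Fin m × Fin n, ∑ b ∈ range n, 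
      (if a ≤ e.1.val ∧ b ≤ e.2.val then v e else 0) := fun a _ => sum_comm
  rw [sum_congr rfl this, sum_comm]
  refine sum_congr rfl fun e _ => ?_
  have h1 : ∀ a ∈ range m, ∑ b ∈ range n, (if a ≤ e.1.val ∧ b ≤ e.2.val then v e else 0)
      = if a ≤ e.1.val then (e.2.val + 1) * v e else 0 := by
    intro a _
    by_cases h : a ≤ e.1.val
    · simp only [h, true_and, if_true]
      rw [← sum_filter]
      have : (range n).filter (fun b => b ≤ e.2.val) = range (e.2.val + 1) := by
        ext b; simp; have := e.2.isLt; omega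
      rw [this]; simp
    · simp [h]
  rw [sum_congr rfl h1, ← sum_filter]
  have : (range m).filter (fun b => b ≤ e.1.val) = range (e.1.val + 1) := by
    ext b; simp; have := e.1.isLt; omega
  rw [this]; simp; ring

open Finset in
lemma antichain_min {m n : ℕ} (u v : Fin m × Fin n → ℕ)
    (anti : ∀ e e', u e ≠ 0 → u e' ≠ 0 → e.1 < e'.1 → ¬ e.2 < e'.2)
    (hrow : ∀ i, ∑ j, u (i, j) = ∑ j, v (i, j))
    (hcol : ∀ j, ∑ i, u (i, j) = ∑ i, v (i, j)) :
    ∑ e, u e * ((e.1.val + 1) * (e.2.val + 1)) ≤ ∑ e, v e * ((e.1.val + 1) * (e.2.val + 1)) ∧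
    (∑ e, u e * ((e.1.val + 1) * (e.2.val + 1)) = ∑ e, v e * ((e.1.val + 1) * (e.2.val + 1))
      → u = v) := by
  have key : ∀ (w : Fin m × Fin n → ℕ) a b, seMass w a b + ∑ i, ∑ j, w (i,j) =
      (∑ i : Fin m, if a ≤ i.val then ∑ j, w (i,j) else 0) +
      (∑ j : Fin n, if b ≤ j.val then ∑ i, w (i,j) else 0) +
      ∑ e : Fin m × Fin n, if e.1.val < a ∧ e.2.val < b then w e else 0 := by
    intro w a b
    have e1 : (∑ i : Fin m, if a ≤ i.val then ∑ j, w (i,j) else 0) =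
        ∑ e : Fin m × Fin n, if a ≤ e.1.val then w e else 0 := by
      rw [Fintype.sum_prod_type]
      refine sum_congr rfl fun i _ => ?_
      split_ifs <;> simp
    have e2 : (∑ j : Fin n, if b ≤ j.val then ∑ i, w (i,j) else 0) =
        ∑ e : Fin m × Fin n, if b ≤ e.2.val then w e else 0 := by
      rw [Fintype.sum_prod_type_right]
      refine sum_congr rfl fun i _ => ?_
      split_ifs <;> simp
    rw [e1, e2, ← Fintype.sum_prod_type (f := w), seMass, ← sum_add_distrib, ← sum_add_distrib,
      ← sum_add_distrib]
    refine sum_congr rfl fun e _ => ?_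
    split_ifs <;> omega
  have le : ∀ a b, seMass u a b ≤ seMass v a b := by
    intro a b
    by_cases h : seMass u a b = 0
    · omega
    · have h2 : (∑ e : Fin m × Fin n, if e.1.val < a ∧ e.2.val < b then u e else 0) = 0 := by
        refine sum_eq_zero fun e _ => ?_
        by_contra hne
        apply h
        refine sum_eq_zero fun e' _ => ?_
        by_contra hne'
        simp only [ite_eq_right_iff, not_forall] at hne hne'
        obtain ⟨⟨p1, p2⟩, p3⟩ := hne
        obtain ⟨⟨q1, q2⟩, q3⟩ := hne'
        exact anti e e' p3 q3 (Fin.lt_def.2 (by omega)) (Fin.lt_def.2 (by omega))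
      have k1 := key u a b
      have k2 := key v a b
      simp only [hrow, hcol] at k1
      omega
  rw [← sum_seMass, ← sum_seMass]
  refine ⟨sum_le_sum fun a _ => sum_le_sum fun b _ => le a b, fun heq => ?_⟩
  have h1 := (sum_eq_sum_iff_of_le (fun a _ => sum_le_sum fun b _ => le a b)).1 heq
  have h2 : ∀ a b, seMass u a b = seMass v a b := by
    intro a b
    by_cases ha : a < m
    · by_cases hb : b < n
      · exact (sum_eq_sum_iff_of_le (fun b _ => le a b)).1 (h1 a (mem_range.2 ha)) b (mem_range.2 hb)
      · have : ∀ w : Fin m × Fin n → ℕ, seMass w a b = 0 := fun w =>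
          sum_eq_zero fun e _ => if_neg (by have := e.2.isLt; omega)
        rw [this, this]
    · have : ∀ w : Fin m × Fin n → ℕ, seMass w a b = 0 := fun w =>
        sum_eq_zero fun e _ => if_neg (by have := e.1.isLt; omega)
      rw [this, this]
  have h3 : ∀ (w : Fin m × Fin n → ℕ) e, w e + seMass w (e.1.val+1) e.2.val + seMass w e.1.val (e.2.val+1)
      = seMass w e.1.val e.2.val + seMass w (e.1.val+1) (e.2.val+1) := by
    intro w e
    have : w e = ∑ e', if e' = e then w e' else 0 := by simp
    rw [this]; unfold seMass
    rw [← sum_add_distrib, ← sum_add_distrib, ← sum_add_distrib]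
    refine sum_congr rfl fun e' _ => ?_
    by_cases he : e' = e
    · subst he; simp
    · rw [if_neg he]
      have : e'.1.val ≠ e.1.val ∨ e'.2.val ≠ e.2.val := by
        by_contra hc
        push Not at hc
        exact he (Prod.ext (Fin.ext hc.1) (Fin.ext hc.2))
      split_ifs <;> omega
  funext e
  have a1 := h3 u e
  have a2 := h3 v e
  simp only [h2] at a1
  omega

/-- Mirsky: no chain of length `s+1` implies a colouring by `s` antichains. -/
lemma mirsky {m n : ℕ} (s : ℕ) : ∀ (A : Finset (Fin m × Fin n)),
    (¬ ∃ (r : Fin (s+1) → Fin m) (c : Fin (s+1) → Fin n), StrictMono r ∧ StrictMono c ∧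
      ∀ i, (r i, c i) ∈ A) →
    ∃ κ : Fin m × Fin n → ℕ, (∀ e ∈ A, κ e < s) ∧
      ∀ e ∈ A, ∀ e' ∈ A, κ e = κ e' → e.1 < e'.1 → ¬ e.2 < e'.2 := by
  classical
  induction s with
  | zero =>
    intro A hA
    have : ∀ e, e ∉ A := by
      intro e he
      exact hA ⟨fun _ => e.1, fun _ => e.2, fun i j h => by exfalso; have := Fin.lt_def.1 h; omega, fun i j h => by exfalso; have := Fin.lt_def.1 h; omega, fun _ => he⟩
    exact ⟨fun _ => 0, fun e he => absurd he (this e), fun e he => absurd he (this e)⟩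
  | succ s ih =>
    intro A hA
    let M := A.filter (fun e => ∀ e' ∈ A, e'.1 < e.1 → ¬ e'.2 < e.2)
    obtain ⟨κ, h1, h2⟩ := ih (A.filter (fun e => e ∉ M)) (by
      rintro ⟨r, c, hr, hc, h⟩
      apply hA
      have h0 := h 0
      simp only [M, Finset.mem_filter, not_and, not_forall, not_not] at h0
      obtain ⟨h0A, h0'⟩ := h0
      obtain ⟨e, he, l1, l2⟩ := h0' h0A
      refine ⟨Fin.cons e.1 r, Fin.cons e.2 c, ?_, ?_, ?_⟩
      · exact Fin.strictMono_iff_lt_succ.2 (fun i => by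
          induction i using Fin.cases with
          | zero => simpa using l1
          | succ i => 
            rw [Fin.castSucc_succ, Fin.cons_succ, Fin.cons_succ]
            exact hr Fin.castSucc_lt_succ)
      · exact Fin.strictMono_iff_lt_succ.2 (fun i => by
          induction i using Fin.cases with
          | zero => simpa using l2
          | succ i => 
            rw [Fin.castSucc_succ, Fin.cons_succ, Fin.cons_succ]
            exact hc Fin.castSucc_lt_succ)
      · intro i
        induction i using Fin.cases with
        | zero => simpa using he
        | succ i => simpa using (Finset.mem_filter.1 (h i)).1)
    refine ⟨fun e => if e ∈ M then s else κ e, ?_, ?_⟩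
    · intro e he
      dsimp only
      split_ifs with hM
      · omega
      · have := h1 e (Finset.mem_filter.2 ⟨he, hM⟩); omega
    · intro e he e' he' hκ hlt hlt2
      dsimp only at hκ
      by_cases hM' : e' ∈ M
      · exact (Finset.mem_filter.1 hM').2 e he hlt hlt2
      · rw [if_neg hM'] at hκ
        have b' := h1 e' (Finset.mem_filter.2 ⟨he', hM'⟩)
        by_cases hM : e ∈ M
        · rw [if_pos hM] at hκ; omega
        · rw [if_neg hM] at hκ
          exact h2 e (Finset.mem_filter.2 ⟨he, hM⟩) e' (Finset.mem_filter.2 ⟨he', hM'⟩) hκ hlt hlt2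

/-- ideal of `t`-minors with columns satisfying `B` -/
noncomputable def minorIdeal (K : Type*) [Field K] (m n t : ℕ) (B : Fin n → Prop) :
    Ideal (MvPolynomial (Fin m × Fin n) K) :=
  Ideal.span { p | ∃ (r : Fin t → Fin m) (c : Fin t → Fin n),
    StrictMono r ∧ StrictMono c ∧ (∀ j, B (c j)) ∧
    p = Matrix.det (Matrix.of fun i j => MvPolynomial.X (r i, c j)) }

/-- no `t`-diagonal in the monomial -/
def ChainFree {m n : ℕ} (t : ℕ) (B : Fin n → Prop) (u : Fin m × Fin n →₀ ℕ) : Prop :=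
  ¬ ∃ (r : Fin t → Fin m) (c : Fin t → Fin n), StrictMono r ∧ StrictMono c ∧
      ∀ i, B (c i) ∧ u (r i, c i) ≠ 0

open Classical in
/-- the weight of a variable -/
noncomputable def omW {m n : ℕ} (B : Fin n → Prop) (e : Fin m × Fin n) : ℕ :=
  if B e.2 then (e.1.val + 1) * (e.2.val + 1) else 0

lemma spanning_aux (K : Type*) [Field K] {m n : ℕ} (t : ℕ) (B : Fin n → Prop) :
    ∀ (N : ℕ) (u : Fin m × Fin n →₀ ℕ), Finsupp.weight (omW B) u = N → 
    (monomial u (1 : K)) ∈ (minorIdeal K m n t B).restrictScalars K ⊔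
      Submodule.span K {p | ∃ v, ChainFree t B v ∧ p = monomial v (1 : K)} := by
  classical
  intro N
  induction N using Nat.strong_induction_on with
  | _ N ih =>
  intro u hu
  by_cases hcf : ChainFree t B u
  · exact Submodule.mem_sup_right (Submodule.subset_span ⟨u, hcf, rfl⟩)
  · unfold ChainFree at hcf
    rw [not_not] at hcf
    obtain ⟨r, c, hr, hc, h⟩ := hcf
    let d : Equiv.Perm (Fin t) → (Fin m × Fin n →₀ ℕ) := fun σ => ∑ i, Finsupp.single (r (σ i), c i) 1
    have hd : d 1 ≤ u := by
      intro e
      simp only [d, Finsupp.coe_finset_sum, Finset.sum_apply, Equiv.Perm.coe_one, id]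
      by_cases he : ∃ i, (r i, c i) = e
      · obtain ⟨i, rfl⟩ := he
        rw [Finset.sum_eq_single i]
        · simp; have := (h i).2; omega
        · intro j _ hj
          rw [Finsupp.single_apply, if_neg]
          intro hh
          exact hj (hr.injective (Prod.ext_iff.1 hh).1)
        · simp
      · push Not at he
        rw [Finset.sum_eq_zero]
        · exact Nat.zero_le _
        · intro i _
          rw [Finsupp.single_apply, if_neg (he i)]
    obtain ⟨u', rfl⟩ := exists_add_of_le hd
    have hw : ∀ σ, Finsupp.weight (omW B) (d σ) = ∑ i, ((r (σ i)).val + 1) * ((c i).val + 1) := by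
      intro σ
      simp only [d, map_sum, Finsupp.weight_single, one_smul, omW]
      exact Finset.sum_congr rfl fun i _ => if_pos (h i).1
    have hlt : ∀ σ : Equiv.Perm (Fin t), σ ≠ 1 → Finsupp.weight (omW B) (d σ) < Finsupp.weight (omW B) (d 1) := by
      intro σ hσ
      rw [hw, hw]
      have hf : StrictMono (fun i : Fin t => (r i).val + 1) := fun i j hij => by
        have := Fin.lt_def.1 (hr hij); dsimp only; omega
      have hg : StrictMono (fun i : Fin t => (c i).val + 1) := fun i j hij => by
        have := Fin.lt_def.1 (hc hij); dsimp only; omega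
      have hmono : Monovary (fun i : Fin t => (r i).val + 1) (fun i : Fin t => (c i).val + 1) := by
        intro i j hij
        exact hf.monotone (hg.lt_iff_lt.1 hij).le
      refine (hmono.sum_comp_perm_mul_lt_sum_mul_iff (σ := σ)).2 ?_
      intro hm
      apply hσ
      have : StrictMono σ := by
        have h1 : Monotone σ := by
          intro i j hij
          rcases hij.eq_or_lt with rfl | hij
          · exact le_rfl
          · exact hf.le_iff_le.1 (hm (hg hij))
        exact h1.strictMono_of_injective σ.injective
      have h2 := Subsingleton.elim (StrictMono.orderIsoOfSurjective σ this σ.surjective) (OrderIso.refl _)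
      ext i
      have := congrArg (fun f : Fin t ≃o Fin t => (f i).val) h2
      simpa using this
    have hdet : Matrix.det (Matrix.of fun i j => (X (r i, c j) : MvPolynomial (Fin m × Fin n) K)) = 
        ∑ σ : Equiv.Perm (Fin t), Equiv.Perm.sign σ • monomial (d σ) (1 : K) := by
      rw [Matrix.det_apply]
      refine Finset.sum_congr rfl fun σ _ => ?_
      congr 1
      simp only [d, Matrix.of_apply]
      rw [MvPolynomial.monomial_sum_one]
      rfl
    have hmem : monomial u' (1 : K) * Matrix.det (Matrix.of fun i j => (X (r i, c j) : MvPolynomial (Fin m × Fin n) K)) ∈ 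
        (minorIdeal K m n t B) := Ideal.mul_mem_left _ _ (Ideal.subset_span ⟨r, c, hr, hc, fun j => (h j).1, rfl⟩)
    rw [hdet, Finset.mul_sum, ← Finset.add_sum_erase _ _ (Finset.mem_univ 1)] at hmem
    have e1 : monomial (d 1 + u') (1 : K) = (monomial u' (1:K) * Equiv.Perm.sign (1 : Equiv.Perm (Fin t)) • monomial (d 1) (1:K) + 
      ∑ σ ∈ Finset.univ.erase (1 : Equiv.Perm (Fin t)), monomial u' (1:K) * Equiv.Perm.sign σ • monomial (d σ) (1:K)) - 
      ∑ σ ∈ Finset.univ.erase (1 : Equiv.Perm (Fin t)), monomial u' (1:K) * Equiv.Perm.sign σ • monomial (d σ) (1:K) := by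
      rw [add_sub_cancel_right]
      simp [monomial_mul, add_comm]
    rw [e1]
    refine Submodule.sub_mem _ (Submodule.mem_sup_left hmem) (Submodule.sum_mem _ fun σ hσ => ?_)
    have hσ1 := (Finset.mem_erase.1 hσ).1
    have := ih (Finsupp.weight (omW B) (d σ + u')) (by
      rw [← hu, map_add, map_add]; have := hlt σ hσ1; omega) _ rfl
    have e2 : monomial u' (1:K) * Equiv.Perm.sign σ • monomial (d σ) (1:K) = Equiv.Perm.sign σ • monomial (d σ + u') (1:K) := by
      rw [mul_smul_comm, monomial_mul, add_comm, one_mul]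
    rw [e2]
    rcases Int.units_eq_one_or (Equiv.Perm.sign σ) with hs | hs
    · rw [hs, one_smul]; exact this
    · rw [hs, Units.neg_smul, one_smul]; exact Submodule.neg_mem _ this

lemma spanning (K : Type*) [Field K] {m n : ℕ} (t : ℕ) (B : Fin n → Prop)
    (g : MvPolynomial (Fin m × Fin n) K) : ∃ g', g - g' ∈ minorIdeal K m n t B ∧ 
      ∀ v ∈ g'.support, ChainFree t B v := by
  classical
  have hg : g ∈ (minorIdeal K m n t B).restrictScalars K ⊔
      Submodule.span K {p | ∃ v, ChainFree t B v ∧ p = monomial v (1 : K)} := by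
    rw [g.as_sum]
    refine Submodule.sum_mem _ fun v _ => ?_
    have : monomial v (coeff v g) = (coeff v g) • monomial v (1 : K) := by
      rw [smul_monomial, smul_eq_mul, mul_one]
    rw [this]
    exact Submodule.smul_mem _ _ (spanning_aux K t B _ v rfl)
  obtain ⟨p, hp, q, hq, rfl⟩ := Submodule.mem_sup.1 hg
  refine ⟨q, by simpa using hp, ?_⟩
  clear hg hp
  induction hq using Submodule.span_induction with
  | mem x hx =>
    obtain ⟨v, hv, rfl⟩ := hx
    intro w hw
    have := support_monomial_subset hw
    rw [Finset.mem_singleton] at this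
    rwa [this]
  | zero => simp
  | add x y _ _ hx hy =>
    intro v hv
    rcases Finset.mem_union.1 (support_add hv) with h | h
    · exact hx v h
    · exact hy v h
  | smul a x _ hx =>
    intro v hv
    exact hx v (support_smul hv)

/-- polarization -/
noncomputable def psi1 (K : Type*) [Field K] (m n s : ℕ) :
    MvPolynomial (Fin m × Fin n) K →ₐ[K] MvPolynomial ((Fin m × Fin n) × Fin s) K :=
  aeval fun e => ∑ k, X (e, k)

open Classical in
/-- exponent vector of the image of a variable in the parametrization -/
noncomputable def contW {m n : ℕ} (s : ℕ) (B : Fin n → Prop) (p : (Fin m × Fin n) × Fin s) :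
    ((Fin m × Fin s) ⊕ ((Fin n × Fin s) ⊕ ((Fin m × Fin n) × Fin s))) →₀ ℕ :=
  if B p.1.2 then Finsupp.single (Sum.inl (p.1.1, p.2)) 1 +
    Finsupp.single (Sum.inr (Sum.inl (p.1.2, p.2))) 1
  else Finsupp.single (Sum.inr (Sum.inr p)) 1

/-- monomial map -/
noncomputable def psi2 (K : Type*) [Field K] (m n s : ℕ) (B : Fin n → Prop) :
    MvPolynomial ((Fin m × Fin n) × Fin s) K →ₐ[K] 
    MvPolynomial ((Fin m × Fin s) ⊕ ((Fin n × Fin s) ⊕ ((Fin m × Fin n) × Fin s))) K :=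
  aeval fun p => monomial (contW s B p) 1

lemma psi2_monomial (K : Type*) [Field K] (m n s : ℕ) (B : Fin n → Prop)
    (w : (Fin m × Fin n) × Fin s →₀ ℕ) (a : K) :
    psi2 K m n s B (monomial w a) = monomial (Finsupp.weight (contW s B) w) a := by
  rw [psi2, aeval_monomial, Finsupp.weight_apply, Finsupp.sum, Finsupp.prod]
  have : ∀ p ∈ w.support, (monomial (contW s B p) (1:K)) ^ (w p) = monomial (w p • contW s B p) 1 := by
    intro p _
    rw [monomial_pow, one_pow]
  rw [Finset.prod_congr rfl this, ← monomial_sum_one, algebraMap_eq, C_mul_monomial, mul_one]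

lemma weight_fst {E : Type*} {s : ℕ} (w : E × Fin s →₀ ℕ) :
    Finsupp.weight (fun p : E × Fin s => Finsupp.single p.1 1) w = w.mapDomain Prod.fst := by
  rw [Finsupp.weight_apply, Finsupp.mapDomain]
  refine Finsupp.sum_congr fun p _ => ?_
  simp

lemma psi1_support (K : Type*) [Field K] (m n s : ℕ) (g : MvPolynomial (Fin m × Fin n) K)
    (w : (Fin m × Fin n) × Fin s →₀ ℕ) (hw : coeff w (psi1 K m n s g) ≠ 0) :
    w.mapDomain Prod.fst ∈ g.support := by
  rw [g.as_sum, map_sum, coeff_sum] at hw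
  obtain ⟨v, hv, hne⟩ := Finset.exists_ne_zero_of_sum_ne_zero hw
  have hom : IsWeightedHomogeneous (fun p : (Fin m × Fin n) × Fin s => Finsupp.single p.1 1)
      (psi1 K m n s (monomial v (coeff v g))) v := by
    rw [psi1, aeval_monomial, algebraMap_eq]
    refine IsWeightedHomogeneous.C_mul ?_ _
    rw [Finsupp.prod]
    have : v = ∑ e ∈ v.support, v e • Finsupp.single e 1 := by
      conv_lhs => rw [← Finsupp.sum_single v]
      rw [Finsupp.sum]
      exact Finset.sum_congr rfl fun e _ => by simp
    conv => arg 3; rw [this]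
    refine IsWeightedHomogeneous.prod _ _ _ fun e _ => ?_
    refine IsWeightedHomogeneous.pow ?_ _
    refine IsWeightedHomogeneous.sum _ _ _ fun k _ => ?_
    exact isWeightedHomogeneous_X K (fun p : (Fin m × Fin n) × Fin s => Finsupp.single p.1 1) (e, k)
  have := hom hne
  rw [weight_fst] at this
  rwa [this]

lemma content_unique {m n s : ℕ} (B : Fin n → Prop) (u : Fin m × Fin n →₀ ℕ)
    (κ : Fin m × Fin n → Fin s)
    (hκ : ∀ e e', u e ≠ 0 → u e' ≠ 0 → B e.2 → B e'.2 → κ e = κ e' → e.1 < e'.1 → ¬ e.2 < e'.2)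
    (w : (Fin m × Fin n) × Fin s →₀ ℕ)
    (hw : Finsupp.weight (contW s B) w = Finsupp.weight (contW s B) (u.mapDomain fun e => (e, κ e)))
    (hle : Finsupp.weight (omW B) (w.mapDomain Prod.fst) ≤ Finsupp.weight (omW B) u) :
    w = u.mapDomain fun e => (e, κ e) := by
  classical
  set w0 := u.mapDomain fun e => (e, κ e) with hw0
  have hinj : Function.Injective (fun e : Fin m × Fin n => (e, κ e)) := fun a b h => (Prod.ext_iff.1 h).1
  have hw0v : ∀ e k, w0 (e, k) = if κ e = k then u e else 0 := by
    intro e k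
    split_ifs with h
    · subst h
      exact Finsupp.mapDomain_apply hinj u e
    · refine Finsupp.mapDomain_of_notMem_range u _ ?_
      rintro ⟨e', he'⟩
      simp only [Prod.mk.injEq] at he'
      obtain ⟨rfl, h2⟩ := he'
      exact h h2
  have hu : w0.mapDomain Prod.fst = u := by
    rw [hw0, ← Finsupp.mapDomain_comp]
    exact Finsupp.mapDomain_id
  have hrow : ∀ (x : (Fin m × Fin n) × Fin s →₀ ℕ) i k, Finsupp.weight (contW s B) x (Sum.inl (i,k)) = 
      ∑ j, if B j then x ((i,j),k) else 0 := by
    intro x i k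
    rw [Finsupp.weight_eq_sum, Finsupp.finset_sum_apply, Fintype.sum_prod_type, Fintype.sum_prod_type]
    rw [Finset.sum_eq_single i]
    · refine Finset.sum_congr rfl fun j _ => ?_
      rw [Finset.sum_eq_single k]
      · by_cases hB : B j <;> simp [contW, hB]
      · intro k' _ hk'
        by_cases hB : B j <;> simp [contW, hB, hk']
      · simp
    · intro i' _ hi'
      refine Finset.sum_eq_zero fun j _ => Finset.sum_eq_zero fun k' _ => ?_
      by_cases hB : B j <;> simp [contW, hB, hi']
    · simp
  have hcol : ∀ (x : (Fin m × Fin n) × Fin s →₀ ℕ) j k, Finsupp.weight (contW s B) x (Sum.inr (Sum.inl (j,k))) = 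
      ∑ i, if B j then x ((i,j),k) else 0 := by
    intro x j k
    rw [Finsupp.weight_eq_sum, Finsupp.finset_sum_apply, Fintype.sum_prod_type, Fintype.sum_prod_type]
    refine Finset.sum_congr rfl fun i _ => ?_
    rw [Finset.sum_eq_single j]
    · rw [Finset.sum_eq_single k]
      · by_cases hB : B j <;> simp [contW, hB]
      · intro k' _ hk'
        by_cases hB : B j <;> simp [contW, hB, hk']
      · simp
    · intro j' _ hj'
      refine Finset.sum_eq_zero fun k' _ => ?_
      by_cases hB : B j' <;> simp [contW, hB, hj']
    · simp
  have hout : ∀ (x : (Fin m × Fin n) × Fin s →₀ ℕ) p, ¬ B p.1.2 → Finsupp.weight (contW s B) x (Sum.inr (Sum.inr p)) = x p := by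
    intro x p hp
    rw [Finsupp.weight_eq_sum, Finsupp.finset_sum_apply]
    rw [Finset.sum_eq_single p]
    · simp [contW, hp]
    · intro p' _ hp'
      by_cases hB : B p'.1.2 <;> simp [contW, hB, hp']
    · simp
  let fB : ((Fin m × Fin n) × Fin s →₀ ℕ) → Fin s → Fin m × Fin n → ℕ := fun x k e => if B e.2 then x (e, k) else 0
  have hom : ∀ x : (Fin m × Fin n) × Fin s →₀ ℕ, Finsupp.weight (omW B) (x.mapDomain Prod.fst) = 
      ∑ k, ∑ e, fB x k e * ((e.1.val + 1) * (e.2.val + 1)) := by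
    intro x
    have : Finsupp.weight (omW B) (x.mapDomain Prod.fst) = Finsupp.weight (fun p : (Fin m × Fin n) × Fin s => omW B p.1) x := by
      rw [Finsupp.weight_apply, Finsupp.sum_mapDomain_index, Finsupp.weight_apply]
      · intro; simp
      · intros; rw [add_smul]
    rw [this, Finsupp.weight_eq_sum, Fintype.sum_prod_type_right]
    refine Finset.sum_congr rfl fun k _ => Finset.sum_congr rfl fun e _ => ?_
    by_cases hB : B e.2 <;> simp [fB, omW, hB]
  have hk : ∀ k, _ := fun k => antichain_min (fB w0 k) (fB w k) (by
      intro e e' he he' h1 h2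
      simp only [fB, ne_eq, ite_eq_right_iff, not_forall, hw0v] at he he'
      obtain ⟨b1, c1, d1⟩ := he
      obtain ⟨b2, c2, d2⟩ := he'
      exact hκ e e' d1 d2 b1 b2 (c1.trans c2.symm) h1 h2)
    (by
      intro i
      have := DFunLike.congr_fun hw (Sum.inl (i, k))
      rw [hrow, hrow] at this
      exact this.symm)
    (by
      intro j
      have := DFunLike.congr_fun hw (Sum.inr (Sum.inl (j, k)))
      rw [hcol, hcol] at this
      exact this.symm)
  have hle' : ∑ k, ∑ e, fB w k e * ((e.1.val + 1) * (e.2.val + 1)) ≤ ∑ k, ∑ e, fB w0 k e * ((e.1.val + 1) * (e.2.val + 1)) := by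
    rw [← hom, ← hom, hu]; exact hle
  have heq := (Finset.sum_eq_sum_iff_of_le (fun k _ => (hk k).1)).1 
    (le_antisymm (Finset.sum_le_sum fun k _ => (hk k).1) hle')
  ext ⟨e, k⟩
  by_cases hB : B e.2
  · have := congrFun ((hk k).2 (heq k (Finset.mem_univ k))) e
    simp only [fB, hB, if_true] at this
    exact this.symm
  · have := DFunLike.congr_fun hw (Sum.inr (Sum.inr (e, k)))
    rwa [hout _ _ hB, hout _ _ hB] at this

lemma independent (K : Type*) [Field K] {m n s : ℕ} (hs : 0 < s) (B : Fin n → Prop)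
    (g : MvPolynomial (Fin m × Fin n) K) (hg : ∀ v ∈ g.support, ChainFree (s+1) B v)
    (h0 : psi2 K m n s B (psi1 K m n s g) = 0) : g = 0 := by
  classical
  by_contra hne
  obtain ⟨u, hu, hmax⟩ := Finset.exists_max_image g.support (fun u => Finsupp.weight (omW B) u)
    (support_nonempty.2 hne)
  obtain ⟨κ', h1, h2⟩ := mirsky s (u.support.filter fun e => B e.2) (by
    rintro ⟨r, c, hr, hc, h⟩
    refine hg u hu ⟨r, c, hr, hc, fun i => ?_⟩
    have := Finset.mem_filter.1 (h i)
    exact ⟨this.2, Finsupp.mem_support_iff.1 this.1⟩)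
  let κ : Fin m × Fin n → Fin s := fun e => if h : κ' e < s then ⟨κ' e, h⟩ else ⟨0, hs⟩
  have hκ : ∀ e e', u e ≠ 0 → u e' ≠ 0 → B e.2 → B e'.2 → κ e = κ e' → e.1 < e'.1 → ¬ e.2 < e'.2 := by
    intro e e' he he' b b' hh
    have m1 : e ∈ u.support.filter fun e => B e.2 := Finset.mem_filter.2 ⟨Finsupp.mem_support_iff.2 he, b⟩
    have m2 : e' ∈ u.support.filter fun e => B e.2 := Finset.mem_filter.2 ⟨Finsupp.mem_support_iff.2 he', b'⟩
    simp only [κ, h1 e m1, h1 e' m2, dif_pos, Fin.mk.injEq] at hh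
    exact h2 e m1 e' m2 hh
  set w0 := u.mapDomain fun e => (e, κ e) with hw0
  have hinj : Function.Injective (fun e : Fin m × Fin n => (e, κ e)) := fun a b h => (Prod.ext_iff.1 h).1
  have hkill : ∀ p, killCompl (R := K) hinj (psi1 K m n s p) = p := by
    have : (killCompl (R := K) hinj).comp (psi1 K m n s) = AlgHom.id K _ := by
      refine algHom_ext fun e => ?_
      simp only [AlgHom.comp_apply, psi1, aeval_X, map_sum, AlgHom.id_apply]
      rw [Finset.sum_eq_single (κ e)]
      · have := killCompl_rename_app (R := K) hinj (X e)
        rwa [rename_X] at this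
      · intro k _ hk
        rw [killCompl, aeval_X, dif_neg]
        rintro ⟨e', he'⟩
        simp only [Prod.mk.injEq] at he'
        obtain ⟨rfl, h⟩ := he'
        exact hk h.symm
      · simp
    exact fun p => AlgHom.congr_fun this p
  have hc : coeff w0 (psi1 K m n s g) = coeff u g := by
    rw [hw0, ← coeff_killCompl hinj, hkill]
  have hsum : coeff (Finsupp.weight (contW s B) w0) (psi2 K m n s B (psi1 K m n s g)) = 
      coeff w0 (psi1 K m n s g) := by
    conv_lhs => rw [(psi1 K m n s g).as_sum]
    rw [map_sum, coeff_sum, Finset.sum_eq_single w0]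
    · rw [psi2_monomial, coeff_monomial, if_pos rfl]
    · intro w hw hwne
      rw [psi2_monomial, coeff_monomial, if_neg]
      intro heq
      apply hwne
      refine content_unique B u κ hκ w heq ?_
      exact hmax _ (psi1_support K m n s g w (mem_support_iff.1 hw))
    · intro h
      rw [psi2_monomial, notMem_support_iff.1 h]; simp
  rw [h0, coeff_zero, hc] at hsum
  exact (mem_support_iff.1 hu) hsum.symm

/-- a product through a smaller index has vanishing determinant -/
lemma det_mul_small {R : Type*} [CommRing R] (s : ℕ) (M : Fin (s+1) → Fin s → R)
    (N : Fin s → Fin (s+1) → R) :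
    Matrix.det (Matrix.of fun i j => ∑ k, M i k * N k j) = 0 := by
  have : (Matrix.of fun i j => ∑ k, M i k * N k j) = 
      (Matrix.of fun (i : Fin (s+1)) (k : Fin (s+1)) => (Fin.cons 0 (M i) : Fin (s+1) → R) k) * 
      (Matrix.of fun (k : Fin (s+1)) (j : Fin (s+1)) => (Fin.cons (fun _ => 0) N : Fin (s+1) → Fin (s+1) → R) k j) := by
    ext i j
    simp [Matrix.mul_apply, Fin.sum_univ_succ]
  rw [this, Matrix.det_mul, Matrix.det_eq_zero_of_column_eq_zero 0 (by simp), zero_mul]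

theorem minorIdeal_isPrime (K : Type*) [Field K] (m n t : ℕ) (ht : 1 ≤ t) (B : Fin n → Prop) :
    (minorIdeal K m n t B).IsPrime := by
  classical
  obtain ⟨s, rfl⟩ : ∃ s, t = s + 1 := ⟨t - 1, by omega⟩
  rcases Nat.eq_zero_or_pos s with rfl | hs
  · change (minorIdeal K m n 1 B).IsPrime
    let φ : MvPolynomial (Fin m × Fin n) K →ₐ[K] MvPolynomial (Fin m × Fin n) K := 
      aeval fun e => if B e.2 then 0 else X e
    have : minorIdeal K m n 1 B = RingHom.ker φ := by
      apply le_antisymm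
      · refine Ideal.span_le.2 ?_
        rintro p ⟨r, c, hr, hc, hB, rfl⟩
        rw [SetLike.mem_coe, RingHom.mem_ker]
        rw [Matrix.det_fin_one]
        simp [φ, hB]
      · intro g hg
        have hmk : ∀ e : Fin m × Fin n, B e.2 → (X e : MvPolynomial (Fin m × Fin n) K) ∈ minorIdeal K m n 1 B := by
          intro e he
          refine Ideal.subset_span ⟨fun _ => e.1, fun _ => e.2, fun i j h => by exfalso; have := Fin.lt_def.1 h; omega, fun i j h => by exfalso; have := Fin.lt_def.1 h; omega, fun _ => he, ?_⟩
          rw [Matrix.det_fin_one]; rfl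
        have hcomp : (Ideal.Quotient.mkₐ K (minorIdeal K m n 1 B)).comp φ = Ideal.Quotient.mkₐ K (minorIdeal K m n 1 B) := by
          refine algHom_ext fun e => ?_
          by_cases he : B e.2
          · simp only [AlgHom.comp_apply, φ, aeval_X, he, if_true, map_zero]
            exact (Ideal.Quotient.eq_zero_iff_mem.2 (hmk e he)).symm
          · simp [φ, he]
        have := AlgHom.congr_fun hcomp g
        rw [AlgHom.comp_apply, (RingHom.mem_ker).1 hg, map_zero] at this
        exact Ideal.Quotient.eq_zero_iff_mem.1 this.symm
    rw [this]
    exact RingHom.ker_isPrime _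
  · let φ := (psi2 K m n s B).comp (psi1 K m n s)
    have hle : minorIdeal K m n (s+1) B ≤ RingHom.ker φ := by
      refine Ideal.span_le.2 ?_
      rintro p ⟨r, c, hr, hc, hB, rfl⟩
      rw [SetLike.mem_coe, RingHom.mem_ker, AlgHom.map_det]
      have : φ.mapMatrix (Matrix.of fun i j => X (r i, c j)) = 
          Matrix.of fun i j => ∑ k, X (Sum.inl (r i, k)) * X (Sum.inr (Sum.inl (c j, k))) := by
        ext1 i j
        simp only [AlgHom.mapMatrix_apply, Matrix.map_apply, Matrix.of_apply, φ, AlgHom.comp_apply, psi1, aeval_X, map_sum, psi2, contW, hB, if_true]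
        refine Finset.sum_congr rfl fun k _ => ?_
        rw [X, X, monomial_mul, one_mul]
      rw [this]
      exact det_mul_small s (fun i k => X (Sum.inl (r i, k))) (fun k j => X (Sum.inr (Sum.inl (c j, k))))
    have : minorIdeal K m n (s+1) B = RingHom.ker φ := by
      refine le_antisymm hle fun g hg => ?_
      obtain ⟨g', h1, h2⟩ := spanning K (s+1) B g
      have h3 : g' = 0 := by
        refine independent K hs B g' h2 ?_
        have := hle h1
        rw [RingHom.mem_ker, map_sub, (RingHom.mem_ker).1 hg, zero_sub, neg_eq_zero] at this
        exact this
      rwa [h3, sub_zero] at h1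
    rw [this]
    exact RingHom.ker_isPrime _

lemma genMinors_eq (K : Type*) [Field K] (m n t a b : ℕ) :
    genMinors K m n t 1 m a b = minorIdeal K m n t (fun j => a ≤ j.val + 1 ∧ j.val + 1 ≤ b) := by
  unfold genMinors minorIdeal
  congr 1
  ext p
  constructor
  · rintro ⟨r, c, hr, hc, -, hB, rfl⟩
    exact ⟨r, c, hr, hc, hB, rfl⟩
  · rintro ⟨r, c, hr, hc, hB, rfl⟩
    exact ⟨r, c, hr, hc, fun i => ⟨by omega, by have := (r i).isLt; omega⟩, hB, rfl⟩

/-- any injective map can be sorted -/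
lemma exists_sort {t N : ℕ} (r : Fin t → Fin N) (hr : Function.Injective r) :
    ∃ σ : Equiv.Perm (Fin t), StrictMono (r ∘ σ) :=
  ⟨Tuple.sort r, (Tuple.monotone_sort r).strictMono_of_injective
    (hr.comp (Tuple.sort r).injective)⟩

/-- arbitrary minors lie in the minor ideal -/
lemma det_mem_minorIdeal (K : Type*) [Field K] (m n t : ℕ) (B : Fin n → Prop)
    (r : Fin t → Fin m) (c : Fin t → Fin n) (hB : ∀ j, B (c j)) :
    Matrix.det (Matrix.of fun i j => (X (r i, c j) : MvPolynomial (Fin m × Fin n) K))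
      ∈ minorIdeal K m n t B := by
  by_cases hr : Function.Injective r
  swap
  · simp only [Function.Injective, not_forall] at hr
    obtain ⟨i, j, h, hne⟩ := hr
    rw [Matrix.det_zero_of_row_eq hne]
    · exact Ideal.zero_mem _
    · funext k; simp [h]
  by_cases hc : Function.Injective c
  swap
  · simp only [Function.Injective, not_forall] at hc
    obtain ⟨i, j, h, hne⟩ := hc
    rw [Matrix.det_zero_of_column_eq hne]
    · exact Ideal.zero_mem _
    · intro k; simp [h]
  obtain ⟨σ, hσ⟩ := exists_sort r hr
  obtain ⟨τ, hτ⟩ := exists_sort c hc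
  have h1 : Matrix.det (Matrix.of fun i j => (X ((r ∘ σ) i, (c ∘ τ) j) : MvPolynomial (Fin m × Fin n) K))
      ∈ minorIdeal K m n t B :=
    Ideal.subset_span ⟨_, _, hσ, hτ, fun j => hB _, rfl⟩
  have h2 : Matrix.of (fun i j => (X ((r ∘ σ) i, (c ∘ τ) j) : MvPolynomial (Fin m × Fin n) K))
    = ((Matrix.of fun i j => (X (r i, c j) : MvPolynomial (Fin m × Fin n) K)).submatrix σ id).submatrix id τ := rfl
  rw [h2, Matrix.det_permute', Matrix.det_permute] at h1
  rcases Int.units_eq_one_or (Equiv.Perm.sign σ) with e1 | e1 <;>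
  rcases Int.units_eq_one_or (Equiv.Perm.sign τ) with e2 | e2 <;>
  · rw [e1, e2] at h1
    simpa using h1

lemma notMem_of_eval (K : Type*) [Field K] (m n t : ℕ) (B : Fin n → Prop)
    (A : Fin m × Fin n → K)
    (hA : ∀ (r : Fin t → Fin m) (c : Fin t → Fin n), StrictMono r → StrictMono c → (∀ j, B (c j)) →
      Matrix.det (Matrix.of fun i j => A (r i, c j)) = 0)
    (h : MvPolynomial (Fin m × Fin n) K) (hh : eval A h ≠ 0) : h ∉ minorIdeal K m n t B := by
  intro hm
  apply hh
  have : minorIdeal K m n t B ≤ RingHom.ker (eval A) := by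
    refine Ideal.span_le.2 ?_
    rintro p ⟨r, c, hr, hc, hB, rfl⟩
    rw [SetLike.mem_coe, RingHom.mem_ker, RingHom.map_det, ← hA r c hr hc hB]
    congr 1
    ext i j
    simp
  exact this hm

/-- generic determinants are nonzero -/
lemma det_X_ne_zero (K : Type*) [Field K] (m n t : ℕ) (r : Fin t → Fin m) (c : Fin t → Fin n)
    (hr : Function.Injective r) (hc : Function.Injective c) :
    Matrix.det (Matrix.of fun i j => (X (r i, c j) : MvPolynomial (Fin m × Fin n) K)) ≠ 0 := by
  classical
  intro h
  have h2 := congrArg (eval (fun e : Fin m × Fin n => if ∃ i, e = (r i, c i) then (1:K) else 0)) h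
  rw [RingHom.map_det, map_zero] at h2
  have : (eval (fun e : Fin m × Fin n => if ∃ i, e = (r i, c i) then (1:K) else 0)).mapMatrix
     (Matrix.of fun i j => (X (r i, c j) : MvPolynomial (Fin m × Fin n) K)) = 1 := by
    ext i j
    simp only [RingHom.mapMatrix_apply, Matrix.map_apply, Matrix.of_apply, eval_X, Matrix.one_apply]
    congr 1
    apply propext
    constructor
    · rintro ⟨k, hk⟩
      rw [Prod.mk.injEq] at hk
      rw [hr hk.1, hc hk.2]
    · rintro rfl; exact ⟨i, rfl⟩
  rw [this, Matrix.det_one] at h2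
  exact one_ne_zero h2

lemma knutsonF_ne_zero (K : Type*) [Field K] (m n : ℕ) (hm : 0 < m) (hmn : m < n) :
    knutsonF K m n hm hmn ≠ 0 := by
  unfold knutsonF
  refine mul_ne_zero (Finset.prod_ne_zero_iff.2 fun k _ => mul_ne_zero ?_ ?_)
    (Finset.prod_ne_zero_iff.2 fun k _ => ?_)
  · exact det_X_ne_zero K m n _ (fun i : Fin (k.val+1) => (⟨m - 1 - k.val + i.val, by omega⟩ : Fin m))
      (fun j => ⟨j.val, by omega⟩)
      (fun i j h => by simpa [Fin.ext_iff] using h) (fun i j h => by simpa [Fin.ext_iff] using h)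
  · exact det_X_ne_zero K m n _ (fun i : Fin (k.val+1) => (⟨i.val, by omega⟩ : Fin m))
      (fun j => ⟨n - 1 - k.val + j.val, by omega⟩)
      (fun i j h => by simpa [Fin.ext_iff] using h) (fun i j h => by simpa [Fin.ext_iff] using h)
  · exact det_X_ne_zero K m n _ (fun i : Fin m => (⟨i.val, i.isLt⟩ : Fin m))
      (fun j => ⟨k.val + j.val, by omega⟩)
      (fun i j h => by simpa [Fin.ext_iff] using h) (fun i j h => by simpa [Fin.ext_iff] using h)

lemma isKnutson_of_dvd {K : Type*} [Field K] {m n : ℕ} (f G : MvPolynomial (Fin m × Fin n) K)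
    (hf : f ≠ 0) (h : G ∣ f) : IsKnutson f (Ideal.span {G}) := by
  obtain ⟨q, rfl⟩ := h
  have hq : q ≠ 0 := right_ne_zero_of_mul hf
  have := IsKnutson.colon (f := G * q) _ (Ideal.span {q}) IsKnutson.base
  convert this using 1
  ext x
  rw [Submodule.mem_colon, Ideal.mem_span_singleton]
  constructor
  · rintro ⟨y, rfl⟩ s hs
    obtain ⟨z, rfl⟩ := Ideal.mem_span_singleton.1 hs
    exact Ideal.mem_span_singleton.2 ⟨y * z, by simp only [smul_eq_mul]; ring⟩
  · intro h
    have := h q (Ideal.mem_span_singleton_self q)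
    rw [smul_eq_mul] at this
    exact (mul_dvd_mul_iff_right hq).1 (Ideal.mem_span_singleton.1 this)

/-- colon by an element outside a prime -/
lemma isKnutson_of_colon {K : Type*} [Field K] {m n : ℕ} (f h : MvPolynomial (Fin m × Fin n) K)
    (J P : Ideal (MvPolynomial (Fin m × Fin n) K)) (hP : P.IsPrime) (hJ : IsKnutson f J)
    (hJP : J ≤ P) (hh : h ∉ P) (hm : ∀ p ∈ P, h * p ∈ J) : IsKnutson f P := by
  have := IsKnutson.colon (f := f) _ (Ideal.span {h}) hJ
  convert this using 1
  ext x
  rw [Submodule.mem_colon]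
  constructor
  · rintro hx s hs
    obtain ⟨z, rfl⟩ := Ideal.mem_span_singleton.1 hs
    have := J.mul_mem_left z (hm x hx)
    rw [smul_eq_mul]
    convert this using 1
    ring
  · intro h'
    have := hJP (h' h (Ideal.mem_span_singleton_self h))
    rw [smul_eq_mul] at this
    exact (hP.mem_or_mem this).resolve_right hh

/-- minors on an interval of columns (one-based) -/
noncomputable def colIdeal (K : Type*) [Field K] (m n t a b : ℕ) :
    Ideal (MvPolynomial (Fin m × Fin n) K) :=
  minorIdeal K m n t (fun j => a ≤ j.val + 1 ∧ j.val + 1 ≤ b)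

lemma minorIdeal_mono (K : Type*) [Field K] (m n t : ℕ) (B B' : Fin n → Prop) (h : ∀ j, B j → B' j) :
    minorIdeal K m n t B ≤ minorIdeal K m n t B' := by
  refine Ideal.span_le.2 ?_
  rintro p ⟨r, c, hr, hc, hB, rfl⟩
  exact Ideal.subset_span ⟨r, c, hr, hc, fun j => h _ (hB j), rfl⟩

lemma colIdeal_step {K : Type*} [Field K] {m n t a b : ℕ} (ht1 : 1 ≤ t) (htm : t ≤ m) (ha : 1 ≤ a)
    (hb : b ≤ n) (hw : a + t ≤ b) (f : MvPolynomial (Fin m × Fin n) K)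
    (h1 : IsKnutson f (colIdeal K m n t a (b-1))) (h2 : IsKnutson f (colIdeal K m n t (a+1) b)) :
    IsKnutson f (colIdeal K m n t a b) := by
  classical
  obtain ⟨s, rfl⟩ : ∃ s, t = s + 1 := ⟨t - 1, by omega⟩
  set J := colIdeal K m n (s+1) a (b-1) + colIdeal K m n (s+1) (a+1) b with hJ
  let ρ : Fin s → Fin m := fun p => ⟨p.val, by omega⟩
  let γ : Fin s → Fin n := fun p => ⟨a + p.val, by omega⟩
  let δ : MvPolynomial (Fin m × Fin n) K := Matrix.det (Matrix.of fun i j => X (ρ i, γ j))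
  have hJP : J ≤ colIdeal K m n (s+1) a b := by
    rw [hJ, Submodule.add_eq_sup, sup_le_iff]
    exact ⟨minorIdeal_mono _ _ _ _ _ _ (by intro j; omega), minorIdeal_mono _ _ _ _ _ _ (by intro j; omega)⟩
  have hprime : (colIdeal K m n (s+1) a b).IsPrime := minorIdeal_isPrime K m n (s+1) ht1 _
  have hδ : δ ∉ colIdeal K m n (s+1) a b := by
    refine notMem_of_eval K m n (s+1) _ (fun e => if ∃ p, e = (ρ p, γ p) then (1:K) else 0) ?_ δ ?_
    · intro r c hr hc hB
      obtain ⟨i, hi⟩ : ∃ i, s ≤ (r i).val := by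
        refine ⟨Fin.last s, ?_⟩
        have : ∀ k : ℕ, (hk : k < s + 1) → k ≤ (r ⟨k, hk⟩).val := by
          intro k
          induction k with
          | zero => intro _; omega
          | succ k ih =>
            intro hk
            have h := ih (by omega)
            have h' := hr (show (⟨k, by omega⟩ : Fin (s+1)) < ⟨k+1, hk⟩ by rw [Fin.lt_def]; simp)
            rw [Fin.lt_def] at h'
            omega
        exact this s (by omega)
      refine Matrix.det_eq_zero_of_row_eq_zero i ?_
      intro j
      rw [Matrix.of_apply, if_neg]
      rintro ⟨p, hp⟩
      rw [Prod.mk.injEq] at hp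
      have := congrArg Fin.val hp.1
      simp only [ρ] at this
      omega
    · rw [RingHom.map_det]
      have : (eval (fun e : Fin m × Fin n => if ∃ i, e = (ρ i, γ i) then (1:K) else 0)).mapMatrix
        (Matrix.of fun i j => (X (ρ i, γ j) : MvPolynomial (Fin m × Fin n) K)) = 1 := by
        ext i j
        simp only [RingHom.mapMatrix_apply, Matrix.map_apply, Matrix.of_apply, eval_X, Matrix.one_apply]
        congr 1
        apply propext
        constructor
        · rintro ⟨k, hk⟩
          simp only [Prod.mk.injEq, ρ, γ, Fin.ext_iff] at hk
          ext; omega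
        · rintro rfl; exact ⟨i, rfl⟩
      rw [this, Matrix.det_one]
      exact one_ne_zero
  have hD : ∀ (i : Fin m) (j : Fin n), a ≤ j.val + 1 → j.val + 1 ≤ b →
      Matrix.det (Matrix.of fun p q => (X ((Fin.cons i ρ : Fin (s+1) → Fin m) p, (Fin.cons j γ : Fin (s+1) → Fin n) q) :
        MvPolynomial (Fin m × Fin n) K)) ∈ J := by
    intro i j hj1 hj2
    by_cases hj : j.val + 1 = b
    · refine Submodule.mem_sup_right (det_mem_minorIdeal K m n (s+1) _ _ _ fun q => ?_)
      refine Fin.cases ?_ (fun q => ?_) q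
      · simp only [Fin.cons_zero]; omega
      · simp only [Fin.cons_succ, γ]; omega
    · refine Submodule.mem_sup_left (det_mem_minorIdeal K m n (s+1) _ _ _ fun q => ?_)
      refine Fin.cases ?_ (fun q => ?_) q
      · simp only [Fin.cons_zero]; omega
      · simp only [Fin.cons_succ, γ]; omega
  have hw : ∃ w : Fin s → Fin n → MvPolynomial (Fin m × Fin n) K, ∀ (i : Fin m) (j : Fin n), 
      a ≤ j.val + 1 → j.val + 1 ≤ b → δ * X (i,j) - ∑ p, X (i, γ p) * w p j ∈ J := by
    refine ⟨fun p j => - ((-1) ^ (p.val + 1) * Matrix.det (Matrix.of fun (x y : Fin s) => 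
      (X (ρ x, (Fin.cons j γ : Fin (s+1) → Fin n) (p.succ.succAbove y)) : MvPolynomial (Fin m × Fin n) K))), ?_⟩
    intro i j h1 h2
    convert hD i j h1 h2 using 1
    rw [Matrix.det_succ_row_zero, Fin.sum_univ_succ, sub_eq_add_neg, ← Finset.sum_neg_distrib]
    congr 1
    · simp only [Fin.val_zero, pow_zero, one_mul, Matrix.of_apply, Fin.cons_zero]
      rw [mul_comm]
      congr 1
    · refine Finset.sum_congr rfl fun p _ => ?_
      simp only [Matrix.of_apply, Fin.cons_zero, Fin.cons_succ, Fin.val_succ]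
      have : ((Matrix.of fun p q => (X ((Fin.cons i ρ : Fin (s+1) → Fin m) p, (Fin.cons j γ : Fin (s+1) → Fin n) q) :
        MvPolynomial (Fin m × Fin n) K)).submatrix Fin.succ p.succ.succAbove) = 
        Matrix.of fun (x y : Fin s) => 
      (X (ρ x, (Fin.cons j γ : Fin (s+1) → Fin n) (p.succ.succAbove y)) : MvPolynomial (Fin m × Fin n) K) := rfl
      rw [this]
      ring
  obtain ⟨w, hw⟩ := hw
  refine isKnutson_of_colon f (δ ^ (s+1)) J _ hprime (IsKnutson.add _ _ h1 h2) hJP ?_ ?_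
  · exact fun h => hδ (hprime.mem_of_pow_mem _ h)
  · have : colIdeal K m n (s+1) a b ≤ J.colon (Ideal.span {δ ^ (s+1)} : Ideal _) := by
      refine Ideal.span_le.2 ?_
      rintro p ⟨r, c, hr, hc, hB, rfl⟩
      rw [SetLike.mem_coe, Submodule.mem_colon]
      intro y hy
      obtain ⟨z, rfl⟩ := Ideal.mem_span_singleton.1 hy
      have key : δ ^ (s+1) * Matrix.det (Matrix.of fun i j => (X (r i, c j) : MvPolynomial (Fin m × Fin n) K)) ∈ J := by
        have e := Matrix.det_smul (Matrix.of fun i j => (X (r i, c j) : MvPolynomial (Fin m × Fin n) K)) δ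
        rw [Fintype.card_fin] at e
        rw [← e, ← Ideal.Quotient.eq_zero_iff_mem, RingHom.map_det,
          ← det_mul_small s (fun i p => Ideal.Quotient.mk J (X (r i, γ p))) (fun p j => Ideal.Quotient.mk J (w p (c j)))]
        congr 1
        ext1 i j
        have := hw (r i) (c j) (hB j).1 (hB j).2
        rw [← Ideal.Quotient.eq_zero_iff_mem, map_sub, sub_eq_zero] at this
        simp only [RingHom.mapMatrix_apply, Matrix.map_apply, Matrix.smul_apply, Matrix.of_apply, smul_eq_mul]
        rw [this, map_sum]
        simp only [map_mul]
      have := J.mul_mem_left z key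
      rw [smul_eq_mul]
      convert this using 1
      ring
    intro p hp
    have := Submodule.mem_colon.1 (this hp) _ (Ideal.mem_span_singleton_self _)
    rwa [smul_eq_mul, mul_comm] at this

lemma colIdeal_of_base {K : Type*} [Field K] {m n t : ℕ} (ht1 : 1 ≤ t) (htm : t ≤ m)
    (f : MvPolynomial (Fin m × Fin n) K)
    (h : ∀ a, 1 ≤ a → a + t ≤ n + 1 → IsKnutson f (colIdeal K m n t a (a + t - 1)))
    (d : ℕ) : ∀ a, 1 ≤ a → a + t + d ≤ n + 1 → IsKnutson f (colIdeal K m n t a (a + t - 1 + d)) := by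
  induction d with
  | zero => intro a h1 h2; exact h a h1 h2
  | succ d ih =>
    intro a h1 h2
    refine colIdeal_step ht1 htm h1 (by omega) (by omega) f ?_ ?_
    · convert ih a h1 (by omega) using 2
      omega
    · convert ih (a+1) (by omega) (by omega) using 2
      omega

/-- the generic matrix extended by antidiagonal unit columns on both sides -/
noncomputable def extM (K : Type*) [Field K] (m n : ℕ) (i : Fin m) (J : ℕ) :
    MvPolynomial (Fin m × Fin n) K :=
  if J < m - 1 then (if i.val + J = m - 2 then 1 else 0)
  else if h : J - (m - 1) < n then X (i, ⟨J - (m - 1), h⟩)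
  else if i.val + J = 2 * m + n - 2 then 1 else 0

lemma extM_real (K : Type*) [Field K] (m n : ℕ) (i : Fin m) (J : ℕ) (j : Fin n) (h : J = m - 1 + j.val) :
    extM K m n i J = X (i, j) := by
  subst h
  have := j.isLt
  rw [extM, if_neg (by omega), dif_pos (by omega)]
  congr 3
  omega

/-- minors on consecutive columns of the extended matrix -/
noncomputable def winD (K : Type*) [Field K] (m n : ℕ) (s c : ℕ) (r : Fin s → Fin m) :
    MvPolynomial (Fin m × Fin n) K :=
  Matrix.det (Matrix.of fun (i k : Fin s) => extM K m n (r i) (c + k.val))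

lemma winD_mem (K : Type*) [Field K] (m n t a0 : ℕ) (hm : 0 < m) (h : a0 + t ≤ n) (s : ℕ) :
    ∀ (c : ℕ) (r : Fin s → Fin m), c ≤ a0 + m - 1 → a0 + m - 1 + t ≤ c + s →
      winD K m n s c r ∈ colIdeal K m n t (a0 + 1) (a0 + t) := by
  induction s with
  | zero =>
    intro c r h1 h2
    have : t = 0 := by omega
    subst this
    exact Ideal.subset_span ⟨Fin.elim0, Fin.elim0, fun i => i.elim0, fun i => i.elim0, fun i => i.elim0, by simp [winD]⟩
  | succ s ih =>
    intro c r h1 h2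
    by_cases hc : c < a0 + m - 1
    · rw [winD, Matrix.det_succ_column_zero]
      refine Ideal.sum_mem _ fun i _ => Ideal.mul_mem_left _ _ ?_
      convert ih (c+1) (r ∘ i.succAbove) (by omega) (by omega) using 1
      rw [winD]
      congr 1
      ext1 x y
      simp only [Matrix.submatrix_apply, Matrix.of_apply, Function.comp, Fin.val_succ]
      congr 1
      omega
    · have hc : c = a0 + m - 1 := by omega
      by_cases ht : t = s + 1
      · subst ht
        have : winD K m n (s+1) c r = Matrix.det (Matrix.of fun i j : Fin (s+1) => X (r i, (⟨a0 + j.val, by omega⟩ : Fin n))) := by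
          rw [winD]
          congr 1
          ext1 i j
          exact extM_real K m n _ _ _ (by simp only; omega)
        rw [this]
        exact det_mem_minorIdeal K m n (s+1) _ r (fun j => (⟨a0 + j.val, by omega⟩ : Fin n)) (fun j => by simp only; omega)
      · rw [winD, Matrix.det_succ_column _ (Fin.last s)]
        refine Ideal.sum_mem _ fun i _ => Ideal.mul_mem_left _ _ ?_
        convert ih c (r ∘ i.succAbove) (by omega) (by omega) using 1
        rw [winD]
        congr 1
        ext1 x y
        simp only [Matrix.submatrix_apply, Matrix.of_apply, Function.comp, Fin.succAbove_last, Fin.val_castSucc]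

lemma exists_factor (K : Type*) [Field K] (m n : ℕ) (hm : 0 < m) (hmn : m < n) (c : ℕ) (hc : c + 2 ≤ n + m) :
    ∃ (s' c' : ℕ) (r : Fin s' → Fin m), winD K m n s' c' r ∣ knutsonF K m n hm hmn ∧
      winD K m n s' c' r ∣ winD K m n m c id ∧ c' = max c (m - 1) ∧ c' + s' = min (c + m) (m + n - 1) := by
  by_cases h1 : c < m - 1
  · refine ⟨c + 1, m - 1, fun i => ⟨m - 1 - c + i.val, by omega⟩, ?_, ?_, by omega, by omega⟩
    · unfold knutsonF
      refine Dvd.dvd.mul_right ?_ _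
      refine Dvd.dvd.trans ?_ (Finset.dvd_prod_of_mem _ (Finset.mem_univ (⟨c, h1⟩ : Fin (m-1))))
      refine Dvd.dvd.mul_right ?_ _
      apply dvd_of_eq
      rw [winD]
      congr 1
      ext1 i j
      exact extM_real K m n _ _ _ rfl
    · rw [winD, winD, Matrix.twoBlockTriangular_det _ (fun i : Fin m => i.val < m - 1 - c)]
      · refine Dvd.dvd.mul_left ?_ _
        apply dvd_of_eq
        let e : Fin (c+1) ≃ {i : Fin m // ¬ i.val < m - 1 - c} :=
          { toFun := fun i => ⟨⟨m - 1 - c + i.val, by omega⟩, by simp only; omega⟩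
            invFun := fun i => ⟨i.1.val - (m - 1 - c), by have := i.1.isLt; omega⟩
            left_inv := fun i => by ext; simp
            right_inv := fun i => by have := i.2; ext; simp only; omega }
        rw [← Matrix.det_submatrix_equiv_self e]
        congr 1
        ext1 i j
        simp only [Matrix.of_apply, Matrix.submatrix_apply, Matrix.toSquareBlockProp, id, e, Equiv.coe_fn_mk, Matrix.toBlock_apply]
        congr 1
        omega
      · intro i hi j hj
        simp only [Matrix.of_apply, id]
        rw [extM, if_pos (by omega), if_neg (by omega)]
  by_cases h2 : c < n
  · refine ⟨m, c, id, ?_, dvd_rfl, by omega, by omega⟩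
    unfold knutsonF
    refine Dvd.dvd.mul_left ?_ _
    refine Dvd.dvd.trans ?_ (Finset.dvd_prod_of_mem _ (Finset.mem_univ (⟨c - (m - 1), by omega⟩ : Fin (n-m+1))))
    apply dvd_of_eq
    rw [winD]
    congr 1
    ext1 i j
    exact extM_real K m n _ _ _ (by simp only; omega)
  · refine ⟨m + n - 1 - c, c, fun i => ⟨i.val, by omega⟩, ?_, ?_, by omega, by omega⟩
    · unfold knutsonF
      refine Dvd.dvd.mul_right ?_ _
      refine Dvd.dvd.trans ?_ (Finset.dvd_prod_of_mem _ (Finset.mem_univ (⟨m + n - 1 - c - 1, by omega⟩ : Fin (m-1))))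
      refine Dvd.dvd.mul_left ?_ _
      apply dvd_of_eq
      have e : m + n - 1 - c - 1 + 1 = m + n - 1 - c := by omega
      rw [winD, ← Matrix.det_submatrix_equiv_self (finCongr e)]
      congr 1
      ext1 i j
      exact extM_real K m n _ _ _ (by simp [finCongr]; omega)
    · rw [winD, winD, Matrix.twoBlockTriangular_det' _ (fun i : Fin m => i.val < m + n - 1 - c)]
      · refine Dvd.dvd.mul_right ?_ _
        apply dvd_of_eq
        let e : Fin (m + n - 1 - c) ≃ {i : Fin m // i.val < m + n - 1 - c} :=
          { toFun := fun i => ⟨⟨i.val, by omega⟩, by simp only; omega⟩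
            invFun := fun i => ⟨i.1.val, i.2⟩
            left_inv := fun i => by ext; simp
            right_inv := fun i => by ext; simp }
        rw [← Matrix.det_submatrix_equiv_self e]
        congr 1
      · intro i hi j hj
        simp only [Matrix.of_apply, id]
        rw [extM, if_neg (by omega), dif_neg (by omega), if_neg (by omega)]

lemma det_rows_mem {R : Type*} [CommRing R] {N : ℕ} (J : Ideal R) (h : R) (A : Matrix (Fin N) (Fin N) R)
    (hA : h * A.det ∈ J) (r : Fin N → Fin N) : h * (A.submatrix r id).det ∈ J := by
  by_cases hr : Function.Injective r
  · have e : A.submatrix r id = A.submatrix (Equiv.ofBijective r (Finite.injective_iff_bijective.1 hr)) id := rfl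
    rw [e, Matrix.det_permute]
    rcases Int.units_eq_one_or (Equiv.Perm.sign (Equiv.ofBijective r (Finite.injective_iff_bijective.1 hr))) with e1 | e1 <;>
    · rw [e1]
      simpa using hA
  · simp only [Function.Injective, not_forall] at hr
    obtain ⟨i, j, h', hne⟩ := hr
    rw [Matrix.det_zero_of_row_eq hne]
    · simp
    · funext k; simp [h']

lemma det_cols_mem {R : Type*} [CommRing R] {N : ℕ} (J : Ideal R) (h : R) (A : Matrix (Fin N) (Fin N) R)
    (hA : h * A.det ∈ J) (r : Fin N → Fin N) : h * (A.submatrix id r).det ∈ J := by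
  rw [← Matrix.det_transpose] at hA ⊢
  exact det_rows_mem J h A.transpose hA r

lemma exchange {R : Type*} [CommRing R] {ι : Type*} (s : ℕ) (J : Ideal R) (u : ι → R) (v : Fin (s+1) → ι → R)
    (h1 h2 : R)
    (H1 : ∀ r : Fin (s+1) → ι, h1 * Matrix.det (Matrix.of fun i k =>
      (Fin.cons u (fun q : Fin s => v q.castSucc) : Fin (s+1) → ι → R) k (r i)) ∈ J)
    (H2 : ∀ r : Fin (s+1) → ι, h2 * Matrix.det (Matrix.of fun i k => v k (r i)) ∈ J)
    (p0 : Fin (s+1)) (ρ : Fin (s+1) → ι) (T : Fin s → ι) :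
    (h1 * h2 * Matrix.det (Matrix.of fun i k =>
      (Fin.cons u (fun q : Fin s => v (p0.succAbove q)) : Fin (s+1) → ι → R) k (ρ i))) *
      Matrix.det (Matrix.of fun i (k : Fin s) => v k.castSucc (T i)) ∈ J := by
  set V := Matrix.det (Matrix.of fun i (k : Fin s) => v k.castSucc (T i)) with hV
  let κ : Fin (s+1) → R := fun i => Matrix.det (Matrix.of fun x (k : Fin s) => v (p0.succAbove k) (ρ (i.succAbove x)))
  let c1 : Fin (s+1) → ι → R := Fin.cons u (fun q : Fin s => v q.castSucc)
  let β : Fin s → R := fun q => Matrix.det (Matrix.of fun x (k : Fin s) => c1 (q.succ.succAbove k) (T x))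
  have e1 : ∀ w : ι → R, Matrix.det (Matrix.of fun i k =>
      (Fin.cons w (fun q : Fin s => v (p0.succAbove q)) : Fin (s+1) → ι → R) k (ρ i)) =
      ∑ i : Fin (s+1), (-1) ^ i.val * w (ρ i) * κ i := by
    intro w
    rw [Matrix.det_succ_column_zero]
    rfl
  have e2 : ∀ i, Matrix.det (Matrix.of fun x k => c1 k ((Fin.cons i T : Fin (s+1) → ι) x)) =
      u i * V + ∑ q : Fin s, (-1) ^ (q.val + 1) * v q.castSucc i * β q := by
    intro i
    rw [Matrix.det_succ_row_zero, Fin.sum_univ_succ]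
    congr 1
    simp only [Fin.val_zero, pow_zero, one_mul, Matrix.of_apply, Fin.cons_zero, c1]
    rfl
  have key : Matrix.det (Matrix.of fun i k =>
      (Fin.cons u (fun q : Fin s => v (p0.succAbove q)) : Fin (s+1) → ι → R) k (ρ i)) * V =
      ∑ i : Fin (s+1), (-1) ^ i.val * κ i * Matrix.det (Matrix.of fun x k => c1 k ((Fin.cons (ρ i) T : Fin (s+1) → ι) x))
      - ∑ q : Fin s, (-1) ^ (q.val + 1) * β q * Matrix.det (Matrix.of fun i k =>
      (Fin.cons (v q.castSucc) (fun q : Fin s => v (p0.succAbove q)) : Fin (s+1) → ι → R) k (ρ i)) := by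
    simp only [e1, e2]
    simp only [mul_add, Finset.sum_add_distrib, Finset.mul_sum, Finset.sum_mul]
    rw [Finset.sum_comm (s := (Finset.univ : Finset (Fin (s+1)))), add_sub_assoc, ← Finset.sum_sub_distrib, eq_comm]
    rw [Finset.sum_eq_zero (s := (Finset.univ : Finset (Fin s))), add_zero]
    · refine Finset.sum_congr rfl fun i _ => by ring
    · intro q _
      rw [← Finset.sum_sub_distrib]
      refine Finset.sum_eq_zero fun i _ => by ring
  have k2 : (h1 * h2 * Matrix.det (Matrix.of fun i k =>
      (Fin.cons u (fun q : Fin s => v (p0.succAbove q)) : Fin (s+1) → ι → R) k (ρ i))) * V =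
      ∑ i : Fin (s+1), (h2 * (-1) ^ i.val * κ i) * (h1 * Matrix.det (Matrix.of fun x k => c1 k ((Fin.cons (ρ i) T : Fin (s+1) → ι) x)))
      - ∑ q : Fin s, (h1 * (-1) ^ (q.val + 1) * β q) * (h2 * Matrix.det (Matrix.of fun i k =>
      (Fin.cons (v q.castSucc) (fun q : Fin s => v (p0.succAbove q)) : Fin (s+1) → ι → R) k (ρ i))) := by
    rw [mul_assoc, key, mul_sub, Finset.mul_sum, Finset.mul_sum]
    congr 1 <;> exact Finset.sum_congr rfl fun i _ => by ring
  rw [k2]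
  refine J.sub_mem (J.sum_mem fun i _ => J.mul_mem_left _ (H1 _)) (J.sum_mem fun q _ => J.mul_mem_left _ ?_)
  convert det_cols_mem J h2 _ (H2 ρ) (Fin.cons q.castSucc p0.succAbove) using 3
  ext1 i k
  refine Fin.cases ?_ (fun k => ?_) k
  · simp
  · simp

/-- the nonvanishing of the auxiliary minor -/
lemma eta_notMem (K : Type*) [Field K] (m n t a0 s c : ℕ) (hm : 0 < m) (hmn : m < n) (ht : 1 ≤ t)
    (h : a0 + t ≤ n) (hs : s + 1 ≤ m) (hc : c ≤ a0 + m - 1) (hc2 : a0 + m - 1 + t ≤ c + s) (cols : Fin (s+1) → ℕ)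
    (hcols : ∀ k, cols k = if k.val ≤ a0 + m - 1 - c then c - 1 + k.val else c + k.val) :
    ∃ ρ : Fin (s+1) → Fin m, Matrix.det (Matrix.of fun i k => extM K m n (ρ i) (cols k)) ∉
      colIdeal K m n t (a0+1) (a0+t) := by
  classical
  obtain ⟨ρ, hinj, hL, hR⟩ : ∃ ρ : Fin (s+1) → Fin m, Function.Injective ρ ∧
    (∀ k, cols k < m - 1 → (ρ k).val + cols k = m - 2) ∧
    (∀ k, m - 1 + n ≤ cols k → (ρ k).val + cols k = 2 * m + n - 2) := by
    by_cases hcase : c + s + 2 ≤ m + n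
    · refine ⟨fun k => ⟨if k.val ≤ m - 1 - c then m - 1 - c - k.val else k.val, by split_ifs <;> omega⟩, ?_, ?_, ?_⟩
      · intro i j hij
        simp only [Fin.mk.injEq] at hij
        ext
        split_ifs at hij <;> omega
      · intro k hk
        rw [hcols] at hk ⊢
        simp only
        split_ifs at hk ⊢ <;> omega
      · intro k hk
        rw [hcols] at hk ⊢
        simp only
        split_ifs at hk ⊢ <;> omega
    · refine ⟨fun k => ⟨if k.val < m + n - 1 - c then k.val else m - 1 + (m + n - 1 - c) - k.val, by split_ifs <;> omega⟩, ?_, ?_, ?_⟩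
      · intro i j hij
        simp only [Fin.mk.injEq] at hij
        ext
        split_ifs at hij <;> omega
      · intro k hk
        rw [hcols] at hk ⊢
        simp only
        split_ifs at hk ⊢ <;> omega
      · intro k hk
        rw [hcols] at hk ⊢
        simp only
        split_ifs at hk ⊢ <;> omega
  have hcinj : Function.Injective cols := by
    intro i j hij
    rw [hcols, hcols] at hij
    ext
    split_ifs at hij <;> omega
  have hne : ∀ k, cols k ≠ a0 + m - 1 := by
    intro k
    rw [hcols]
    split_ifs <;> omega
  refine ⟨ρ, ?_⟩
  refine notMem_of_eval K m n t _ (fun e => if ∃ k, cols k = m - 1 + e.2.val ∧ e.1 = ρ k then (1:K) else 0) ?_ _ ?_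
  · intro r cc hr hcc hB
    have h0 : (cc ⟨0, by omega⟩).val = a0 := by
      have hmono : ∀ k : ℕ, (hk : k < t) → (cc ⟨0, by omega⟩).val + k ≤ (cc ⟨k, hk⟩).val := by
        intro k
        induction k with
        | zero => intro _; simp
        | succ k ih =>
          intro hk
          have h := ih (by omega)
          have h' := hcc (show (⟨k, by omega⟩ : Fin t) < ⟨k+1, hk⟩ by rw [Fin.lt_def]; simp)
          rw [Fin.lt_def] at h'
          omega
      have h1 := hmono (t-1) (by omega)
      have h2 := (hB ⟨t-1, by omega⟩).2
      have h3 := (hB ⟨0, by omega⟩).1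
      omega
    refine Matrix.det_eq_zero_of_column_eq_zero ⟨0, by omega⟩ fun i => ?_
    rw [Matrix.of_apply, if_neg]
    rintro ⟨k, hk, -⟩
    simp only [h0] at hk
    exact hne k (by omega)
  · rw [RingHom.map_det]
    have : (eval (fun e : Fin m × Fin n => if ∃ k, cols k = m - 1 + e.2.val ∧ e.1 = ρ k then (1:K) else 0)).mapMatrix
        (Matrix.of fun i k => extM K m n (ρ i) (cols k)) = 1 := by
      ext1 i j
      simp only [RingHom.mapMatrix_apply, Matrix.map_apply, Matrix.of_apply, Matrix.one_apply]
      have hij : i = j ↔ (ρ i).val = (ρ j).val := by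
        rw [← Fin.ext_iff, hinj.eq_iff]
      rw [extM]
      split_ifs with g1 g2 g3 g3 g4 g5 g6 g7 g8
      all_goals first | exact map_one _ | exact map_zero _ | skip
      · exact absurd (hij.2 (by have := hL j g1; omega)) g3
      · exact absurd (by have := hL j g1; have := hij.1 g3; omega) g2
      · rw [eval_X, if_pos ⟨j, by simp only; omega, by rw [g5]⟩]
      · rw [eval_X, if_neg]
        rintro ⟨k, hk, hk2⟩
        simp only at hk hk2
        have : k = j := hcinj (by omega)
        exact g5 (hinj (by rw [hk2, this]))
      · exact absurd (hij.2 (by have := hR j (by omega); omega)) g7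
      · exact absurd (by have := hR j (by omega); have := hij.1 g8; omega) g6
    rw [this, Matrix.det_one]
    exact one_ne_zero

lemma exists_sumIdeal (K : Type*) [Field K] (m n t a0 : ℕ) (hm : 0 < m) (hmn : m < n) (ht : 1 ≤ t) (htm : t ≤ m)
    (h : a0 + t ≤ n) (l : ℕ) (hl : l ≤ m - t) :
    ∃ J : Ideal (MvPolynomial (Fin m × Fin n) K), IsKnutson (knutsonF K m n hm hmn) J ∧
      J ≤ colIdeal K m n t (a0+1) (a0+t) ∧
      ∀ k ≤ l, winD K m n m (a0 + t - 1 + k) id ∈ J := by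
  have single : ∀ k ≤ m - t, ∃ J : Ideal (MvPolynomial (Fin m × Fin n) K), IsKnutson (knutsonF K m n hm hmn) J ∧
      J ≤ colIdeal K m n t (a0+1) (a0+t) ∧ winD K m n m (a0 + t - 1 + k) id ∈ J := by
    intro k hk
    obtain ⟨s', c', r, h1, h2, h3, h4⟩ := exists_factor K m n hm hmn (a0 + t - 1 + k) (by omega)
    refine ⟨Ideal.span {winD K m n s' c' r}, isKnutson_of_dvd _ _ (knutsonF_ne_zero K m n hm hmn) h1, ?_, 
      Ideal.mem_span_singleton.2 h2⟩
    rw [Ideal.span_singleton_le_iff_mem]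
    exact winD_mem K m n t a0 hm h s' c' r (by omega) (by omega)
  induction l with
  | zero =>
    obtain ⟨J, h1, h2, h3⟩ := single 0 (by omega)
    refine ⟨J, h1, h2, fun k hk => ?_⟩
    obtain rfl : k = 0 := by omega
    exact h3
  | succ l ih =>
    obtain ⟨J, h1, h2, h3⟩ := ih (by omega)
    obtain ⟨J', h1', h2', h3'⟩ := single (l+1) hl
    refine ⟨J + J', IsKnutson.add _ _ h1 h1', ?_, fun k hk => ?_⟩
    · rw [Submodule.add_eq_sup]; exact sup_le h2 h2'
    · rcases Nat.lt_or_ge l k with hlt | hge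
      · obtain rfl : k = l + 1 := by omega
        exact Submodule.mem_sup_right h3'
      · exact Submodule.mem_sup_left (h3 k hge)

lemma descend (K : Type*) [Field K] (m n t a0 : ℕ) (hm : 0 < m) (hmn : m < n) (ht : 1 ≤ t) (htm : t ≤ m)
    (h : a0 + t ≤ n) (J : Ideal (MvPolynomial (Fin m × Fin n) K))
    (hJ : ∀ k ≤ m - t, winD K m n m (a0 + t - 1 + k) id ∈ J) (d : ℕ) :
    ∀ s c, s + d = m → c ≤ a0 + m - 1 → a0 + m - 1 + t ≤ c + s →
      ∃ q, q ∉ colIdeal K m n t (a0+1) (a0+t) ∧ ∀ r : Fin s → Fin m, q * winD K m n s c r ∈ J := by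
  have hprime : (colIdeal K m n t (a0+1) (a0+t)).IsPrime := minorIdeal_isPrime K m n t ht _
  induction d with
  | zero =>
    intro s c hs h1 h2
    obtain rfl : s = m := by omega
    refine ⟨1, fun hh => hprime.ne_top ((Ideal.eq_top_iff_one _).2 hh), fun r => ?_⟩
    have hc := hJ (c - (a0 + t - 1)) (by omega)
    rw [show a0 + t - 1 + (c - (a0 + t - 1)) = c by omega] at hc
    rw [← one_mul (winD K s n s c id)] at hc
    exact det_rows_mem J 1 _ hc r
  | succ d ih =>
    intro s c hs h1 h2
    obtain ⟨q1, hq1, H1⟩ := ih (s+1) (c-1) (by omega) (by omega) (by omega)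
    obtain ⟨q2, hq2, H2⟩ := ih (s+1) c (by omega) (by omega) (by omega)
    let p0 : Fin (s+1) := ⟨a0 + m - 1 - c, by omega⟩
    obtain ⟨ρ, hρ⟩ := eta_notMem K m n t a0 s c hm hmn ht h (by omega) h1 h2
      (fun k => if k.val ≤ a0 + m - 1 - c then c - 1 + k.val else c + k.val) (fun k => rfl)
    refine ⟨_, ?_, fun T => exchange s J (fun i => extM K m n i (c - 1)) (fun k i => extM K m n i (c + k.val)) q1 q2 ?_ H2 p0 ρ T⟩
    · intro hmem
      rcases hprime.mem_or_mem hmem with hmem | hmem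
      · rcases hprime.mem_or_mem hmem with hmem | hmem
        · exact hq1 hmem
        · exact hq2 hmem
      · apply hρ
        convert hmem using 3
        ext1 i; funext k
        refine Fin.cases ?_ (fun k => ?_) k
        · simp
        · simp only [Matrix.of_apply, Fin.cons_succ, Fin.val_succ, Fin.succAbove, p0, Fin.lt_def, Fin.val_castSucc]
          congr 1
          split_ifs <;> simp only [Fin.val_castSucc, Fin.val_succ] <;> omega
    · intro r
      convert H1 r using 2
      rw [winD]
      congr 1
      ext1 i k
      refine Fin.cases ?_ (fun k => ?_) k
      · simp
      · simp only [Matrix.of_apply, Fin.cons_succ, Fin.val_succ, Fin.val_castSucc]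
        congr 1
        omega

lemma colIdeal_base (K : Type*) [Field K] (m n t : ℕ) (hm : 0 < m) (hmn : m < n) (ht : 1 ≤ t) (htm : t ≤ m)
    (a : ℕ) (ha : 1 ≤ a) (h : a + t ≤ n + 1) :
    IsKnutson (knutsonF K m n hm hmn) (colIdeal K m n t a (a + t - 1)) := by
  obtain ⟨a0, rfl⟩ : ∃ a0, a = a0 + 1 := ⟨a - 1, by omega⟩
  rw [show a0 + 1 + t - 1 = a0 + t by omega]
  obtain ⟨J, h1, h2, h3⟩ := exists_sumIdeal K m n t a0 hm hmn ht htm (by omega) (m - t) le_rfl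
  obtain ⟨q, hq, hr⟩ := descend K m n t a0 hm hmn ht htm (by omega) J h3 (m - t) t (a0 + m - 1) (by omega) le_rfl le_rfl
  refine isKnutson_of_colon _ q J _ (minorIdeal_isPrime K m n t ht _) h1 h2 hq ?_
  intro p hp
  refine Submodule.span_induction ?_ ?_ ?_ ?_ hp
  · rintro x ⟨r, c, hr', hc, hB, rfl⟩
    convert hr r using 2
    rw [winD]
    congr 1
    ext1 i j
    refine (extM_real K m n _ _ _ ?_).symm
    have e1 : ∀ k : ℕ, (hk : k < t) → a0 + k ≤ (c ⟨k, hk⟩).val := by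
      intro k
      induction k with
      | zero => intro hk; have := (hB ⟨0, hk⟩).1; omega
      | succ k ih =>
        intro hk
        have h := ih (by omega)
        have h' := hc (show (⟨k, by omega⟩ : Fin t) < ⟨k+1, hk⟩ by rw [Fin.lt_def]; simp)
        rw [Fin.lt_def] at h'
        omega
    have e2 : ∀ k : ℕ, (hk : k < t) → (c ⟨t - 1 - k, by omega⟩).val + k + 1 ≤ a0 + t := by
      intro k
      induction k with
      | zero => intro hk; have := (hB ⟨t-1-0, by omega⟩).2; omega
      | succ k ih =>
        intro hk
        have h := ih (by omega)
        have h' := hc (show (⟨t-1-(k+1), by omega⟩ : Fin t) < ⟨t-1-k, by omega⟩ by rw [Fin.lt_def]; simp only; omega)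
        rw [Fin.lt_def] at h'
        omega
    have f1 := e1 j.val j.isLt
    have f2 := e2 (t - 1 - j.val) (by omega)
    have f3 : (⟨t - 1 - (t - 1 - j.val), by omega⟩ : Fin t) = j := by ext; simp only; omega
    rw [f3] at f2
    simp only [Fin.eta] at f1
    omega
  · simp
  · intro x y _ _ hx hy
    rw [mul_add]; exact J.add_mem hx hy
  · intro z x _ hx
    rw [smul_eq_mul, mul_left_comm]
    exact J.mul_mem_left z hx

theorem determinantal_cols_isKnutson (K : Type*) [Field K] (m n : ℕ)
    (hm : 0 < m) (hmn : m < n) (t : ℕ) (ht1 : 1 ≤ t) (htm : t ≤ m)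
    (a b : ℕ) (ha : 1 ≤ a) (hab : a < b) (hb : b ≤ n) (hw : t ≤ b - a + 1) :
    IsKnutson (knutsonF K m n hm hmn) (genMinors K m n t 1 m a b) := by
  rw [genMinors_eq]
  have := colIdeal_of_base ht1 htm (knutsonF K m n hm hmn)
    (fun a h1 h2 => colIdeal_base K m n t hm hmn ht1 htm a h1 h2) (b + 1 - a - t) a ha (by omega)
  rw [show a + t - 1 + (b + 1 - a - t) = b by omega] at this
  exact this
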